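/- arXiv:1703.00960 — 6 statements merged into one kernel-verified Lean document; each statement's English description precedes it below -/
import Mathlib

section
/- Let E be a real inner product space and O a finite set. Suppose h, k : O → E are families of vectors such that (i) ⟨h_a, h_b⟩ = 0 and ⟨k_a, k_b⟩ = 0 for all a ≠ b in O, (ii) ⟨h_a, k_b⟩ ≥ 0 for all a, b ∈ O and ⟨h_a, k_b⟩ = 0 for a ≠ b, (iii) ∑_{a ∈ O} ⟨h_a, k_a⟩ = 1, (iv) ∑_{a ∈ O} ‖h_a‖² = 1 and ∑_{a ∈ O} ‖k_a‖² = 1. Then h_a = k_a for every a ∈ O. -/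
open scoped RealInnerProductSpace

/-- **Vector-strategy rigidity** (Proposition 2.1): for a perfect vect-strategy of a
synchronous game, the two families of vectors must coincide. -/
theorem vect_strategy_rigidity {E : Type*} [NormedAddCommGroup E] [InnerProductSpace ℝ E]
    {O : Type*} [Fintype O] (h k : O → E)
    (horth : ∀ a b : O, a ≠ b → ⟪h a, h b⟫ = 0)
    (korth : ∀ a b : O, a ≠ b → ⟪k a, k b⟫ = 0)
    (hpos : ∀ a b : O, 0 ≤ ⟪h a, k b⟫)
    (hzero : ∀ a b : O, a ≠ b → ⟪h a, k b⟫ = 0)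
    (hsum : ∑ a : O, ⟪h a, k a⟫ = 1)
    (hnorm : ∑ a : O, ‖h a‖ ^ 2 = 1)
    (knorm : ∑ a : O, ‖k a‖ ^ 2 = 1) :
    ∀ a : O, h a = k a := by
  have hdist : ∑ a : O, ‖h a - k a‖ ^ 2 = 0 := by
    simp only [norm_sub_sq_real, Finset.sum_add_distrib, Finset.sum_sub_distrib,
      ← Finset.mul_sum, hsum, hnorm, knorm]
    norm_num
  intro a
  have ha := (Finset.sum_eq_zero_iff_of_nonneg fun a _ => sq_nonneg ‖h a - k a‖).mp hdist a
    (Finset.mem_univ a)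
  exact sub_eq_zero.mp (norm_eq_zero.mp (pow_eq_zero_iff two_ne_zero |>.mp ha))
end

section
/- Let A be a unital ℂ-algebra with a star-ring structure that is conjugate-linear on scalars, let P ⊆ A be the set of all finite sums of elements of the form star(f)·f, and let I ⊆ A be a two-sided ideal with star(I) = I. Then I is hereditary — i.e. for all f, h: if f ∈ P and h − f ∈ P and h ∈ I then f ∈ I — if and only if for every self-adjoint x ∈ A the following holds: if there exist p ∈ P and q ∈ P with x − p ∈ I and x + q ∈ I, then x ∈ I. -/
/-- In a unital complex `*`-algebra `A`, let `P` be the set of finite sums of elements of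
the form `star f * f` and let `I` be a star-closed two-sided ideal.  Then `I` is
hereditary (`f ∈ P`, `h - f ∈ P`, `h ∈ I` imply `f ∈ I`) if and only if for every
self-adjoint `x`, the existence of `p, q ∈ P` with `x - p ∈ I` and `x + q ∈ I` forces
`x ∈ I`; i.e. the induced cone on `A/I` is proper. -/
theorem hereditary_iff_proper_cone {A : Type*} [Ring A] [Algebra ℂ A] [StarRing A]
    [StarModule ℂ A]
    (P : Set A)
    (hP : P = (AddSubmonoid.closure {a : A | ∃ f : A, a = star f * f} : Set A))
    (I : TwoSidedIdeal A) (hIstar : ∀ x : A, x ∈ I → star x ∈ I) :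
    (∀ f h : A, f ∈ P → h - f ∈ P → h ∈ I → f ∈ I) ↔
      (∀ x : A, IsSelfAdjoint x →
        (∃ p ∈ P, ∃ q ∈ P, x - p ∈ I ∧ x + q ∈ I) → x ∈ I) := by
  subst hP
  constructor
  · rintro hered x - ⟨p, hp, q, hq, hxp, hxq⟩
    have hpq : p + q ∈ I := by
      have := I.sub_mem hxq hxp
      rwa [add_sub_sub_cancel, add_comm] at this
    have hpI : p ∈ I := hered p (p + q) hp (by rwa [add_sub_cancel_left]) hpq
    simpa using I.add_mem hxp hpI
  · intro proper f h hf hhf hI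
    have hsa : IsSelfAdjoint f := by
      clear hhf
      induction hf using AddSubmonoid.closure_induction with
      | mem a ha =>
        obtain ⟨g, rfl⟩ := ha
        exact IsSelfAdjoint.star_mul_self g
      | zero => exact IsSelfAdjoint.zero A
      | add a b _ _ ha hb => exact ha.add hb
    refine proper f hsa ⟨f, hf, h - f, hhf, ?_, ?_⟩
    · simp
    · rwa [add_sub_cancel]
end

section
/- Let n ≥ 1 and m ≥ 1 be integers. Let B(n,m) be the quotient of the free noncommutative unital ℂ-algebra on generators x_{v,a} (v ∈ Fin n, a ∈ Fin m) by the two-sided ideal I(n,m) generated by x_{v,a}² − x_{v,a} for all v, a; 1 − ∑_{a ∈ Fin m} x_{v,a} for all v; and x_{v,a}·x_{v,b} for all v and a ≠ b. Let F(n,m) be the free product of n copies of the cyclic group of order m (Monoid.CoprodI of the family of groups Multiplicative (ZMod m) indexed by Fin n), let u_v ∈ MonoidAlgebra ℂ F(n,m) be the group element given by the generator of the v-th free factor, let ω = exp(2πi/m), and set e_{v,a} = (1/m) ∑_{k=0}^{m−1} ω^{−ak} u_v^k. Then there is a ℂ-algebra isomorphism π : B(n,m) → MonoidAlgebra ℂ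 F(n,m) sending the class of x_{v,a} to e_{v,a} for every v and a. -/
noncomputable section

/-- `F(n,m)`: the free product of `n` copies of the cyclic group of order `m`. -/
abbrev FreeProdCyclic (n m : ℕ) : Type :=
  Monoid.CoprodI (fun _ : Fin n => Multiplicative (ZMod m))

/-- `u_v`: the generator of the `v`-th free factor, viewed inside the group algebra
`ℂ[F(n,m)]`. -/
def uGen (n m : ℕ) (v : Fin n) : MonoidAlgebra ℂ (FreeProdCyclic n m) :=
  MonoidAlgebra.of ℂ (FreeProdCyclic n m)
    (Monoid.CoprodI.of (i := v) (Multiplicative.ofAdd (1 : ZMod m)))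

/-- The spectral idempotent `e_{v,a} = (1/m) ∑_{k=0}^{m-1} ω^{-ak} u_v^k`, where
`ω = exp(2πi/m)`. -/
def eProj (n m : ℕ) (v : Fin n) (a : Fin m) : MonoidAlgebra ℂ (FreeProdCyclic n m) :=
  (m : ℂ)⁻¹ • ∑ k ∈ Finset.range m,
    (Complex.exp (2 * Real.pi * Complex.I / (m : ℂ)) ^ (-((a : ℤ) * (k : ℤ)))) •
      uGen n m v ^ k

/-- The generating set of the ideal `I(n,m)`: `x_{v,a}² - x_{v,a}`;
`1 - ∑ₐ x_{v,a}`; and `x_{v,a} x_{v,b}` for `a ≠ b`. -/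
def bGens (n m : ℕ) : Set (FreeAlgebra ℂ (Fin n × Fin m)) :=
  {p | ∃ (v : Fin n) (a : Fin m),
        p = FreeAlgebra.ι ℂ (v, a) * FreeAlgebra.ι ℂ (v, a) - FreeAlgebra.ι ℂ (v, a)} ∪
  {p | ∃ v : Fin n, p = 1 - ∑ a : Fin m, FreeAlgebra.ι ℂ (v, a)} ∪
  {p | ∃ (v : Fin n) (a b : Fin m), a ≠ b ∧
        p = FreeAlgebra.ι ℂ (v, a) * FreeAlgebra.ι ℂ (v, b)}

/-- `B(n,m)`: the quotient of the free `ℂ`-algebra on `Fin n × Fin m` by the two-sided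
ideal `I(n,m)` generated by `bGens n m` (realized via `RingQuot`). -/
abbrev BAlg (n m : ℕ) :=
  RingQuot (fun p q : FreeAlgebra ℂ (Fin n × Fin m) => p ∈ bGens n m ∧ q = 0)

/-- The spectral component `(1/m) ∑_{k<m} ζ^{-ak} u^k` of an element `u`
at `ζ ^ a`. -/
def specProj {A : Type*} [Ring A] [Algebra ℂ A] (ζ : ℂ) (m : ℕ) (u : A) (a : Fin m) : A :=
  (m : ℂ)⁻¹ • ∑ k ∈ Finset.range m, (ζ ^ (-((a : ℤ) * (k : ℤ)))) • u ^ k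

section Spectral

variable {A : Type*} [Ring A] [Algebra ℂ A] {ζ : ℂ} {m : ℕ}

theorem IsPrimitiveRoot.sum_range_zpow_mul_pow (hζ : IsPrimitiveRoot ζ m) (a b : Fin m) :
    ∑ k ∈ Finset.range m, ζ ^ (-((a : ℤ) * (k : ℤ))) * (ζ ^ (b : ℕ)) ^ k =
      if a = b then (m : ℂ) else 0 := by
  have hm : m ≠ 0 := (Fin.pos a).ne'
  have h0 : ζ ≠ 0 := hζ.ne_zero hm
  have key : ∀ k : ℕ, ζ ^ (-((a : ℤ) * (k : ℤ))) * (ζ ^ (b : ℕ)) ^ k =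
      (ζ ^ ((b : ℤ) - (a : ℤ))) ^ k := fun k => by
    rw [← zpow_natCast, ← zpow_natCast, ← zpow_natCast, ← zpow_mul, ← zpow_mul, ← zpow_add₀ h0]
    congr 1
    ring
  simp only [key]
  split_ifs with h
  · simp [h]
  · have hz : ζ ^ ((b : ℤ) - (a : ℤ)) ≠ 1 := fun h1 => h <| by
      have hd := (hζ.zpow_eq_one_iff_dvd _).1 h1
      have := Int.eq_zero_of_abs_lt_dvd hd (by rw [abs_lt]; omega)
      ext
      omega
    have hp : (ζ ^ ((b : ℤ) - (a : ℤ))) ^ m = 1 := by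
      rw [← zpow_natCast, ← zpow_mul, mul_comm, zpow_mul, zpow_natCast, hζ.pow_eq_one, one_zpow]
    rw [geom_sum_eq hz, hp, sub_self, zero_div]

theorem mul_specProj (hζ : IsPrimitiveRoot ζ m) {u : A} (hu : u ^ m = 1) (a : Fin m) :
    u * specProj ζ m u a = ζ ^ (a : ℕ) • specProj ζ m u a := by
  have h0 : ζ ≠ 0 := hζ.ne_zero (Fin.pos a).ne'
  set w : A := ζ ^ (-(a : ℤ)) • u with hw
  have hs : specProj ζ m u a = (m : ℂ)⁻¹ • ∑ k ∈ Finset.range m, w ^ k := by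
    simp only [specProj, hw, smul_pow, ← zpow_natCast, ← zpow_mul, neg_mul]
  have hwm : w ^ m = 1 := by
    rw [hw, smul_pow, hu, ← zpow_natCast, ← zpow_mul, mul_comm, zpow_mul, zpow_natCast,
      hζ.pow_eq_one, one_zpow, one_smul]
  have huw : u = ζ ^ (a : ℕ) • w := by
    rw [hw, smul_smul, ← zpow_natCast, ← zpow_add₀ h0, add_neg_cancel, zpow_zero, one_smul]
  have hg : w * ∑ k ∈ Finset.range m, w ^ k = ∑ k ∈ Finset.range m, w ^ k := by
    have := mul_geom_sum w m
    rwa [hwm, sub_self, sub_mul, one_mul, sub_eq_zero] at this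
  rw [hs, mul_smul_comm]
  conv_lhs => rw [huw]
  rw [smul_mul_assoc, hg, smul_comm]

theorem pow_mul_of_mul_eq_smul {u x : A} {c : ℂ} (h : u * x = c • x) (k : ℕ) :
    u ^ k * x = c ^ k • x := by
  induction k with
  | zero => simp
  | succ k ih => rw [pow_succ, mul_assoc, h, mul_smul_comm, ih, smul_smul, pow_succ']

/-- The spectral component of `u` at `ζ ^ a` kills eigenvectors for `ζ ^ b`, `b ≠ a`, and fixes
those for `ζ ^ a`. -/
theorem specProj_mul_of_mul_eq_smul (hζ : IsPrimitiveRoot ζ m) {u x : A} (a b : Fin m)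
    (h : u * x = ζ ^ (b : ℕ) • x) :
    specProj ζ m u a * x = if a = b then x else 0 := by
  have hm : (m : ℂ) ≠ 0 := Nat.cast_ne_zero.2 (Fin.pos a).ne'
  simp only [specProj, smul_mul_assoc, Finset.sum_mul, pow_mul_of_mul_eq_smul h, smul_smul]
  rw [← Finset.sum_smul, hζ.sum_range_zpow_mul_pow, smul_smul]
  split_ifs <;> simp [hm]

theorem sum_specProj (hζ : IsPrimitiveRoot ζ m) (hm : m ≠ 0) (u : A) :
    ∑ a : Fin m, specProj ζ m u a = 1 := by
  have hmc : (m : ℂ) ≠ 0 := Nat.cast_ne_zero.2 hm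
  have hsum : ∀ k : Fin m, ∑ a : Fin m, ζ ^ (-((a : ℤ) * (k : ℤ))) =
      if k = ⟨0, Nat.pos_of_ne_zero hm⟩ then (m : ℂ) else 0 := fun k => by
    rw [← hζ.sum_range_zpow_mul_pow k ⟨0, Nat.pos_of_ne_zero hm⟩,
      Finset.sum_range (n := m)]
    simp [mul_comm]
  simp only [specProj]
  rw [← Finset.smul_sum]
  simp only [Finset.sum_range]
  rw [Finset.sum_comm]
  simp only [← Finset.sum_smul, hsum]
  simp [ite_smul, hmc]

theorem sum_smul_specProj (hζ : IsPrimitiveRoot ζ m) (hm : m ≠ 0) {u : A} (hu : u ^ m = 1) :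
    ∑ a : Fin m, ζ ^ (a : ℕ) • specProj ζ m u a = u := by
  simp only [← mul_specProj hζ hu]
  rw [← Finset.mul_sum, sum_specProj hζ hm, mul_one]

theorem completeOrthogonalIdempotents_specProj (hζ : IsPrimitiveRoot ζ m) (hm : m ≠ 0) {u : A}
    (hu : u ^ m = 1) : CompleteOrthogonalIdempotents (specProj ζ m u) where
  idem a := by
    simpa [IsIdempotentElem] using specProj_mul_of_mul_eq_smul hζ a a (mul_specProj hζ hu a)
  ortho a b hab := by
    simpa [hab] using specProj_mul_of_mul_eq_smul hζ a b (mul_specProj hζ hu b)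
  complete := sum_specProj hζ hm u

variable {e : Fin m → A}

theorem CompleteOrthogonalIdempotents.sum_smul_mul (he : CompleteOrthogonalIdempotents e)
    (c : Fin m → ℂ) (b : Fin m) : (∑ a, c a • e a) * e b = c b • e b := by
  simp [Finset.sum_mul, he.mul_eq]

theorem CompleteOrthogonalIdempotents.sum_smul_pow_eq_one (he : CompleteOrthogonalIdempotents e)
    (hζ : IsPrimitiveRoot ζ m) : (∑ a : Fin m, ζ ^ (a : ℕ) • e a) ^ m = 1 := by
  rw [← mul_one ((∑ a : Fin m, ζ ^ (a : ℕ) • e a) ^ m), ← he.complete, Finset.mul_sum]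
  refine Finset.sum_congr rfl fun b _ => ?_
  rw [pow_mul_of_mul_eq_smul (he.sum_smul_mul _ b), ← pow_mul, mul_comm, pow_mul, hζ.pow_eq_one,
    one_pow, one_smul]

theorem CompleteOrthogonalIdempotents.specProj_sum_smul (he : CompleteOrthogonalIdempotents e)
    (hζ : IsPrimitiveRoot ζ m) (a : Fin m) :
    specProj ζ m (∑ b : Fin m, ζ ^ (b : ℕ) • e b) a = e a := by
  rw [← mul_one (specProj ζ m _ a), ← he.complete, Finset.mul_sum]
  simp [fun b => specProj_mul_of_mul_eq_smul hζ a b (he.sum_smul_mul (fun b => ζ ^ (b : ℕ)) b)]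

theorem map_specProj {B : Type*} [Ring B] [Algebra ℂ B] (f : A →ₐ[ℂ] B) (u : A) (a : Fin m) :
    f (specProj ζ m u a) = specProj ζ m (f u) a := by
  simp [specProj]

end Spectral

/-- The homomorphism out of the cyclic group of order `m` sending the generator to an element
`x` with `x ^ m = 1`. -/
def zmodPowHom {M : Type*} [Monoid M] {m : ℕ} [NeZero m] (x : M) (hx : x ^ m = 1) :
    Multiplicative (ZMod m) →* M where
  toFun k := x ^ k.toAdd.val
  map_one' := by simp
  map_mul' j k := by
    rw [toAdd_mul, ZMod.val_add, ← pow_add, ← pow_eq_pow_mod _ hx]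

theorem uGen_pow_val {n m : ℕ} [NeZero m] (v : Fin n) (k : Multiplicative (ZMod m)) :
    uGen n m v ^ k.toAdd.val =
      MonoidAlgebra.of ℂ (FreeProdCyclic n m) (Monoid.CoprodI.of (i := v) k) := by
  rw [uGen, ← map_pow, ← map_pow, ← ofAdd_nsmul]
  simp

theorem uGen_pow_eq_one (n m : ℕ) (v : Fin n) : uGen n m v ^ m = 1 := by
  rw [uGen, ← map_pow, ← map_pow, ← ofAdd_nsmul]
  simp [MonoidAlgebra.one_def]

/-- The class of `x_{v,a}` in `B(n,m)`. -/
def bGen (n m : ℕ) (v : Fin n) (a : Fin m) : BAlg n m :=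
  RingQuot.mkAlgHom ℂ _ (FreeAlgebra.ι ℂ (v, a))

theorem mkAlgHom_eq_zero {n m : ℕ} {p : FreeAlgebra ℂ (Fin n × Fin m)} (hp : p ∈ bGens n m) :
    (RingQuot.mkAlgHom ℂ _ p : BAlg n m) = 0 := by
  have h := RingQuot.mkAlgHom_rel ℂ
    (s := fun p q : FreeAlgebra ℂ (Fin n × Fin m) => p ∈ bGens n m ∧ q = 0) ⟨hp, rfl⟩
  rwa [map_zero] at h

theorem completeOrthogonalIdempotents_bGen (n m : ℕ) (v : Fin n) :
    CompleteOrthogonalIdempotents (bGen n m v) where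
  idem a := by
    have := mkAlgHom_eq_zero (n := n) (m := m) (Or.inl (Or.inl ⟨v, a, rfl⟩))
    rwa [map_sub, map_mul, sub_eq_zero] at this
  ortho a b hab := by
    have := mkAlgHom_eq_zero (n := n) (m := m) (Or.inr ⟨v, a, b, hab, rfl⟩)
    rwa [map_mul] at this
  complete := by
    have := mkAlgHom_eq_zero (n := n) (m := m) (Or.inl (Or.inr ⟨v, rfl⟩))
    rw [map_sub, map_one, map_sum, sub_eq_zero] at this
    exact this.symm

/-- The homomorphism out of `B(n,m)` determined by `n` complete families of orthogonal
idempotents. -/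
def bLift {n m : ℕ} {A : Type*} [Ring A] [Algebra ℂ A] (e : Fin n → Fin m → A)
    (he : ∀ v, CompleteOrthogonalIdempotents (e v)) : BAlg n m →ₐ[ℂ] A :=
  RingQuot.liftAlgHom ℂ ⟨FreeAlgebra.lift ℂ fun p => e p.1 p.2, by
    rintro p q ⟨(⟨v, a, rfl⟩ | ⟨v, rfl⟩) | ⟨v, a, b, hab, rfl⟩, rfl⟩
    · simp [((he v).idem a).eq]
    · simp [(he v).complete]
    · simp [(he v).mul_eq, hab]⟩

theorem bLift_bGen {n m : ℕ} {A : Type*} [Ring A] [Algebra ℂ A] (e : Fin n → Fin m → A)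
    (he : ∀ v, CompleteOrthogonalIdempotents (e v)) (v : Fin n) (a : Fin m) :
    bLift e he (bGen n m v a) = e v a := by
  simp [bLift, bGen]

/-- The homomorphism out of `ℂ[F(n,m)]` determined by `n` elements of order dividing `m`. -/
def groupLift {n m : ℕ} [NeZero m] {A : Type*} [Ring A] [Algebra ℂ A] (U : Fin n → A)
    (hU : ∀ v, U v ^ m = 1) : MonoidAlgebra ℂ (FreeProdCyclic n m) →ₐ[ℂ] A :=
  MonoidAlgebra.lift ℂ A _ (Monoid.CoprodI.lift fun v => zmodPowHom (U v) (hU v))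

theorem groupLift_of {n m : ℕ} [NeZero m] {A : Type*} [Ring A] [Algebra ℂ A] (U : Fin n → A)
    (hU : ∀ v, U v ^ m = 1) (v : Fin n) (k : Multiplicative (ZMod m)) :
    groupLift U hU (MonoidAlgebra.of ℂ _ (Monoid.CoprodI.of (i := v) k)) =
      U v ^ k.toAdd.val := by
  simp [groupLift, zmodPowHom]

theorem groupLift_uGen {n m : ℕ} [NeZero m] {A : Type*} [Ring A] [Algebra ℂ A] (U : Fin n → A)
    (hU : ∀ v, U v ^ m = 1) (v : Fin n) : groupLift U hU (uGen n m v) = U v := by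
  rw [uGen, groupLift_of, toAdd_ofAdd, ZMod.val_one_eq_one_mod, ← pow_eq_pow_mod _ (hU v), pow_one]

/-- There is a `ℂ`-algebra isomorphism `π : B(n,m) ≃ ℂ[F(n,m)]` sending the class of
`x_{v,a}` to the spectral idempotent `e_{v,a}`. -/
theorem bAlg_iso_monoidAlgebra (n m : ℕ) (hn : 1 ≤ n) (hm : 1 ≤ m) :
    ∃ π : BAlg n m ≃ₐ[ℂ] MonoidAlgebra ℂ (FreeProdCyclic n m),
      ∀ (v : Fin n) (a : Fin m),
        π (RingQuot.mkAlgHom ℂ _ (FreeAlgebra.ι ℂ (v, a))) = eProj n m v a := by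
  have hm0 : m ≠ 0 := by omega
  have : NeZero m := ⟨hm0⟩
  set ζ : ℂ := Complex.exp (2 * Real.pi * Complex.I / (m : ℂ))
  have hζ : IsPrimitiveRoot ζ m := Complex.isPrimitiveRoot_exp m hm0
  have hE : ∀ v a, eProj n m v a = specProj ζ m (uGen n m v) a := fun _ _ => rfl
  have he : ∀ v, CompleteOrthogonalIdempotents (eProj n m v) := fun v =>
    completeOrthogonalIdempotents_specProj hζ hm0 (uGen_pow_eq_one n m v)
  have hb := completeOrthogonalIdempotents_bGen n m
  let U : Fin n → BAlg n m := fun v => ∑ a : Fin m, ζ ^ (a : ℕ) • bGen n m v a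
  have hU : ∀ v, U v ^ m = 1 := fun v => (hb v).sum_smul_pow_eq_one hζ
  have hfU : ∀ v, bLift _ he (U v) = uGen n m v := fun v => by
    simp only [U, map_sum, map_smul, bLift_bGen, hE]
    exact sum_smul_specProj hζ hm0 (uGen_pow_eq_one n m v)
  refine ⟨AlgEquiv.ofAlgHom (bLift _ he) (groupLift U hU) ?_ ?_, fun v a => bLift_bGen _ he v a⟩
  · refine MonoidAlgebra.algHom_ext' ?_ (Subsingleton.elim _ _)
    refine Monoid.CoprodI.ext_hom _ _ fun v => MonoidHom.ext fun k => ?_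
    change bLift _ he (groupLift U hU (MonoidAlgebra.of ℂ (FreeProdCyclic n m)
      (Monoid.CoprodI.of (i := v) k))) =
        MonoidAlgebra.of ℂ (FreeProdCyclic n m) (Monoid.CoprodI.of (i := v) k)
    rw [groupLift_of, map_pow, hfU, uGen_pow_val]
  · refine RingQuot.ringQuot_ext' _ _ _ (FreeAlgebra.hom_ext (funext fun ⟨v, a⟩ => ?_))
    change groupLift U hU (bLift _ he (bGen n m v a)) = bGen n m v a
    rw [bLift_bGen, hE, map_specProj, groupLift_uGen]
    exact (hb v).specProj_sum_smul hζ a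

end
end

section
/- Let G be a connected simple graph on a finite vertex set with more than one vertex. Then 1 ∉ I(G,2) if and only if G is 2-colorable (G.Colorable 2). Equivalently, for such G the algebraic chromatic number equals 2 if and only if the chromatic number equals 2. -/
noncomputable section

/-- The generator `x_{v,i}` of the free `ℂ`-algebra `F(G,c)` on `V × Fin c`. -/
def colGen {V : Type*} (c : ℕ) (v : V) (i : Fin c) : FreeAlgebra ℂ (V × Fin c) :=
  FreeAlgebra.ι ℂ (v, i)

/-- The generating set of the coloring ideal `I(G,c)`:  `x_{v,i} x_{v,j}` for `i ≠ j`;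
`x_{v,i}² - x_{v,i}`;  `1 - ∑ᵢ x_{v,i}`;  and `x_{v,i} x_{w,i}` for adjacent `v, w`. -/
def colGens {V : Type*} (G : SimpleGraph V) (c : ℕ) : Set (FreeAlgebra ℂ (V × Fin c)) :=
  {a | ∃ v : V, ∃ i j : Fin c, i ≠ j ∧ a = colGen c v i * colGen c v j} ∪
  {a | ∃ v : V, ∃ i : Fin c, a = colGen c v i * colGen c v i - colGen c v i} ∪
  {a | ∃ v : V, a = 1 - ∑ i : Fin c, colGen c v i} ∪
  {a | ∃ v w : V, ∃ i : Fin c, G.Adj v w ∧ a = colGen c v i * colGen c w i}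

/-- The coloring ideal `I(G,c)`, a two-sided ideal of `F(G,c)`. -/
def colIdeal {V : Type*} (G : SimpleGraph V) (c : ℕ) :
    TwoSidedIdeal (FreeAlgebra ℂ (V × Fin c)) :=
  TwoSidedIdeal.span (colGens G c)

/-- The algebraic chromatic number `χ_alg(G)`: the least `c` with `1 ∉ I(G,c)`. -/
def chiAlg {V : Type*} (G : SimpleGraph V) : ℕ :=
  sInf {c : ℕ | (1 : FreeAlgebra ℂ (V × Fin c)) ∉ colIdeal G c}

end

noncomputable section

theorem one_notMem_colIdeal_of_colorable {V : Type*} {G : SimpleGraph V} {c : ℕ}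
    (h : G.Colorable c) : (1 : FreeAlgebra ℂ (V × Fin c)) ∉ colIdeal G c := by
  obtain ⟨C⟩ := h
  let φ : FreeAlgebra ℂ (V × Fin c) →ₐ[ℂ] ℂ :=
    FreeAlgebra.lift ℂ fun x => if C x.1 = x.2 then 1 else 0
  have hφ (v : V) (i : Fin c) : φ (colGen c v i) = if C v = i then 1 else 0 := by
    simp [φ, colGen]
  have hle : colIdeal G c ≤ TwoSidedIdeal.ker φ := by
    refine TwoSidedIdeal.span_le.2 ?_
    rintro a (((⟨v, i, j, hij, rfl⟩ | ⟨v, i, rfl⟩) | ⟨v, rfl⟩) | ⟨v, w, i, hvw, rfl⟩)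
    · have : ¬(C v = i ∧ C v = j) := fun h => hij (h.1.symm.trans h.2)
      simp only [SetLike.mem_coe, TwoSidedIdeal.mem_ker, map_mul, hφ]
      grind
    · by_cases h : C v = i <;> simp [TwoSidedIdeal.mem_ker, hφ, h]
    · simp [TwoSidedIdeal.mem_ker, hφ]
    · have : C v ≠ C w := C.valid hvw
      simp only [SetLike.mem_coe, TwoSidedIdeal.mem_ker, map_mul, hφ]
      grind
  intro h1
  simpa [TwoSidedIdeal.mem_ker] using hle h1

/-- A connected graph is `2`-colorable if it carries a ring-valued function whose values at adjacent
vertices are complementary and never equal to their own complement. -/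
theorem SimpleGraph.Connected.colorable_two_of_adj_eq_one_sub {V R : Type*} [Ring R]
    {G : SimpleGraph V} (hconn : G.Connected) (p : V → R)
    (hadj : ∀ v w, G.Adj v w → p w = 1 - p v) (hne : ∀ v, p v ≠ 1 - p v) :
    G.Colorable 2 := by
  classical
  obtain ⟨u⟩ := hconn.nonempty
  have hp (v : V) : p v = p u ∨ p v = 1 - p u := by
    obtain ⟨W⟩ := hconn.preconnected v u
    induction W with
    | nil => exact Or.inl rfl
    | cons h _ ih =>
      rw [hadj _ _ h.symm]
      rcases ih with ih | ih <;> simp [ih]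
  let C : G.Coloring Prop := SimpleGraph.Coloring.mk (fun v => p v = p u) <| by
    intro v w hvw heq
    have hcompl := hadj v w hvw
    refine hne v ?_
    by_cases hv : p v = p u
    · have hw : p w = p u := heq.mp hv
      rw [← hcompl, hv, hw]
    · have hw : p w ≠ p u := fun hw => hv (heq.mpr hw)
      rw [← hcompl, (hp v).resolve_left hv, (hp w).resolve_left hw]
  simpa using C.colorable

theorem colorable_two_of_one_notMem_colIdeal {V : Type*} {G : SimpleGraph V}
    (hconn : G.Connected) (h : (1 : FreeAlgebra ℂ (V × Fin 2)) ∉ colIdeal G 2) :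
    G.Colorable 2 := by
  let π := (colIdeal G 2).ringCon.mk'
  have hπ (a : FreeAlgebra ℂ (V × Fin 2)) : π a = 0 ↔ a ∈ colIdeal G 2 := by
    rw [← TwoSidedIdeal.mem_ker, TwoSidedIdeal.ker_ringCon_mk']
  have hgen {a : FreeAlgebra ℂ (V × Fin 2)} (ha : a ∈ colGens G 2) : π a = 0 :=
    (hπ a).2 (TwoSidedIdeal.subset_span ha)
  have hidem (v : V) : π (colGen 2 v 0) * π (colGen 2 v 0) = π (colGen 2 v 0) := by
    rw [← sub_eq_zero, ← map_mul, ← map_sub]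
    exact hgen (Or.inl (Or.inl (Or.inr ⟨v, 0, rfl⟩)))
  have hsum (v : V) : π (colGen 2 v 1) = 1 - π (colGen 2 v 0) := by
    have := hgen (Or.inl (Or.inr ⟨v, rfl⟩))
    rw [map_sub, map_one, Fin.sum_univ_two, map_add, sub_eq_zero] at this
    rw [this, add_sub_cancel_left]
  have hmul (v w : V) (i : Fin 2) (hvw : G.Adj v w) :
      π (colGen 2 v i) * π (colGen 2 w i) = 0 := by
    rw [← map_mul]
    exact hgen (Or.inr ⟨v, w, i, hvw, rfl⟩)
  refine hconn.colorable_two_of_adj_eq_one_sub (fun v => π (colGen 2 v 0)) ?_ ?_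
  · intro v w hvw
    have h0 := hmul v w 0 hvw
    have h1 := hmul v w 1 hvw
    rw [hsum, hsum, sub_mul, one_mul, mul_sub, mul_one, h0, sub_zero] at h1
    exact eq_sub_of_add_eq (by rw [← sub_eq_zero, ← neg_eq_zero, ← h1]; abel)
  · intro v hv
    have hzero : π (colGen 2 v 0) = 0 := by
      rw [← hidem v]
      nth_rw 2 [hv]
      rw [mul_sub, mul_one, hidem, sub_self]
    refine h ((hπ 1).1 ?_)
    rw [hzero, sub_zero] at hv
    rw [map_one, ← hv]

/-- For a connected graph on a finite vertex set with more than one vertex,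
`1 ∉ I(G,2)` iff `G` is `2`-colorable; i.e. `χ_alg(G) = 2 ↔ χ(G) = 2` for such graphs. -/
theorem one_notMem_colIdeal_two_iff {V : Type*} [Fintype V] (G : SimpleGraph V)
    (hconn : G.Connected) (hcard : 1 < Fintype.card V) :
    ((1 : FreeAlgebra ℂ (V × Fin 2)) ∉ colIdeal G 2) ↔ G.Colorable 2 :=
  ⟨colorable_two_of_one_notMem_colIdeal hconn, one_notMem_colIdeal_of_colorable⟩

end
end

section
/- Let G be a simple graph and let v, w be adjacent vertices of G. Then for all i, j ∈ Fin 3, the commutator x_{v,i}·x_{w,j} − x_{w,j}·x_{v,i} belongs to the coloring ideal I(G,3). In particular, if G is a complete graph then the algebra A(G,K_3) is commutative. -/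
/-- If `p` and `q` are families of three elements, each summing to `1`, with `p` orthogonal and
`p k * q k = q k * p k = 0`, then `p i * q j = p i * q j * p i` for `i ≠ j`. -/
theorem mul_eq_mul_mul_of_fin_three {R : Type*} [Ring R] {p q : Fin 3 → R}
    (hp : ∀ i j, i ≠ j → p i * p j = 0) (hp1 : ∑ i, p i = 1) (hq1 : ∑ i, q i = 1)
    (hpq : ∀ i, p i * q i = 0) (hqp : ∀ i, q i * p i = 0) {i j : Fin 3} (hij : i ≠ j) :
    p i * q j = p i * q j * p i ∧ q j * p i = p i * q j * p i := by
  have sandwich : ∀ k l, k ≠ l → k ≠ j → l ≠ j → p k * q j * p l = 0 := by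
    intro k l hkl hkj hlj
    have h : ∑ m, p k * q m * p l = p k * q j * p l := by
      refine Finset.sum_eq_single j (fun m _ hm => ?_) (by simp)
      obtain rfl | rfl : m = k ∨ m = l := by omega
      · rw [hpq, zero_mul]
      · rw [mul_assoc, hqp, mul_zero]
    rw [← h, ← Finset.sum_mul, ← Finset.mul_sum, hq1, mul_one, hp k l hkl]
  constructor
  · have h : ∑ m, p i * q j * p m = p i * q j * p i := by
      refine Finset.sum_eq_single i (fun m _ hm => ?_) (by simp)
      by_cases hmj : m = j
      · rw [hmj, mul_assoc, hqp, mul_zero]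
      · exact sandwich i m hm.symm hij hmj
    rw [← h, ← Finset.mul_sum, hp1, mul_one]
  · have h : ∑ m, p m * (q j * p i) = p i * (q j * p i) := by
      refine Finset.sum_eq_single i (fun m _ hm => ?_) (by simp)
      by_cases hmj : m = j
      · rw [hmj, ← mul_assoc, hpq, zero_mul]
      · rw [← mul_assoc]
        exact sandwich m i hm hmj hij
    rw [mul_assoc, ← h, ← Finset.sum_mul, hp1, one_mul]

theorem commute_of_fin_three {R : Type*} [Ring R] {p q : Fin 3 → R}
    (hp : ∀ i j, i ≠ j → p i * p j = 0) (hp1 : ∑ i, p i = 1) (hq1 : ∑ i, q i = 1)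
    (hpq : ∀ i, p i * q i = 0) (hqp : ∀ i, q i * p i = 0) (i j : Fin 3) :
    Commute (p i) (q j) := by
  by_cases hij : i = j
  · subst hij
    exact (hpq i).trans (hqp i).symm
  · obtain ⟨h₁, h₂⟩ := mul_eq_mul_mul_of_fin_three hp hp1 hq1 hpq hqp hij
    exact h₁.trans h₂.symm

theorem FreeAlgebra.commute_map_of_commute_map_ι {R X S : Type*} [CommRing R] [Ring S]
    (f : FreeAlgebra R X →+* S)
    (h : ∀ x y, Commute (f (FreeAlgebra.ι R x)) (f (FreeAlgebra.ι R y)))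
    (a b : FreeAlgebra R X) : Commute (f a) (f b) := by
  have key : ∀ t : S, (∀ r, Commute (f (algebraMap R _ r)) t) →
      (∀ x, Commute (f (FreeAlgebra.ι R x)) t) → ∀ a, Commute (f a) t := by
    intro t hr hx a
    induction a using FreeAlgebra.induction with
    | grade0 r => exact hr r
    | grade1 x => exact hx x
    | mul a b ha hb => rw [map_mul]; exact ha.mul_left hb
    | add a b ha hb => rw [map_add]; exact ha.add_left hb
  have central : ∀ r c, Commute (f (algebraMap R _ r)) (f c) := fun r c =>
    Commute.map (Algebra.commutes r c) f
  exact key _ (fun r => central r b)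
    (fun x => (key _ (fun r => central r _) (fun y => h y x) b).symm) a

theorem TwoSidedIdeal.mem_iff_mk'_eq_zero {R : Type*} [Ring R] (I : TwoSidedIdeal R) (a : R) :
    a ∈ I ↔ I.ringCon.mk' a = 0 := by
  rw [TwoSidedIdeal.mem_iff, ← map_zero I.ringCon.mk']
  exact (RingCon.eq I.ringCon).symm

theorem TwoSidedIdeal.sub_mem_iff_commute {R : Type*} [Ring R] (I : TwoSidedIdeal R) (a b : R) :
    a * b - b * a ∈ I ↔ Commute (I.ringCon.mk' a) (I.ringCon.mk' b) := by
  rw [I.mem_iff_mk'_eq_zero, map_sub, map_mul, map_mul, sub_eq_zero, commute_iff_eq]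

section ColIdeal

variable {V : Type*} (G : SimpleGraph V) (c : ℕ)

theorem mk'_colGen_mul_colGen_of_ne (v : V) {i j : Fin c} (hij : i ≠ j) :
    (colIdeal G c).ringCon.mk' (colGen c v i) * (colIdeal G c).ringCon.mk' (colGen c v j) = 0 := by
  rw [← map_mul, ← TwoSidedIdeal.mem_iff_mk'_eq_zero]
  exact TwoSidedIdeal.subset_span (Or.inl (Or.inl (Or.inl ⟨v, i, j, hij, rfl⟩)))

theorem sum_mk'_colGen (v : V) :
    ∑ i, (colIdeal G c).ringCon.mk' (colGen c v i) = 1 := by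
  rw [← map_sum, eq_comm, ← map_one (colIdeal G c).ringCon.mk', ← sub_eq_zero, ← map_sub,
    ← TwoSidedIdeal.mem_iff_mk'_eq_zero]
  exact TwoSidedIdeal.subset_span (Or.inl (Or.inr ⟨v, rfl⟩))

theorem mk'_colGen_mul_colGen_of_adj {v w : V} (h : G.Adj v w) (i : Fin c) :
    (colIdeal G c).ringCon.mk' (colGen c v i) * (colIdeal G c).ringCon.mk' (colGen c w i) = 0 := by
  rw [← map_mul, ← TwoSidedIdeal.mem_iff_mk'_eq_zero]
  exact TwoSidedIdeal.subset_span (Or.inr ⟨v, w, i, h, rfl⟩)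

theorem commute_mk'_colGen_same (v : V) (i j : Fin c) :
    Commute ((colIdeal G c).ringCon.mk' (colGen c v i))
      ((colIdeal G c).ringCon.mk' (colGen c v j)) := by
  by_cases hij : i = j
  · rw [hij]
  · exact (mk'_colGen_mul_colGen_of_ne G c v hij).trans
      (mk'_colGen_mul_colGen_of_ne G c v (Ne.symm hij)).symm

theorem commute_mk'_colGen_of_adj {v w : V} (h : G.Adj v w) (i j : Fin 3) :
    Commute ((colIdeal G 3).ringCon.mk' (colGen 3 v i))
      ((colIdeal G 3).ringCon.mk' (colGen 3 w j)) :=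
  commute_of_fin_three (p := fun i => (colIdeal G 3).ringCon.mk' (colGen 3 v i))
    (q := fun j => (colIdeal G 3).ringCon.mk' (colGen 3 w j))
    (fun _ _ => mk'_colGen_mul_colGen_of_ne G 3 v) (sum_mk'_colGen G 3 v) (sum_mk'_colGen G 3 w)
    (mk'_colGen_mul_colGen_of_adj G 3 h) (mk'_colGen_mul_colGen_of_adj G 3 h.symm) i j

end ColIdeal

noncomputable section

/-- For adjacent vertices `v, w` of `G`, all commutators `x_{v,i} x_{w,j} - x_{w,j} x_{v,i}`
lie in the coloring ideal `I(G,3)`; in particular, for a complete graph the quotient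
algebra `A(G,K_3)` is commutative (all commutators lie in `I(G,3)`). -/
theorem commutator_mem_colIdeal_three {V : Type*} (G : SimpleGraph V) :
    (∀ v w : V, G.Adj v w → ∀ i j : Fin 3,
      colGen 3 v i * colGen 3 w j - colGen 3 w j * colGen 3 v i ∈ colIdeal G 3) ∧
    ((∀ v w : V, v ≠ w → G.Adj v w) →
      ∀ a b : FreeAlgebra ℂ (V × Fin 3), a * b - b * a ∈ colIdeal G 3) := by
  refine ⟨fun v w h i j => ?_, fun hG a b => ?_⟩
  · rw [TwoSidedIdeal.sub_mem_iff_commute]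
    exact commute_mk'_colGen_of_adj G h i j
  · rw [TwoSidedIdeal.sub_mem_iff_commute]
    refine FreeAlgebra.commute_map_of_commute_map_ι _ ?_ a b
    rintro ⟨v, i⟩ ⟨w, j⟩
    by_cases hvw : v = w
    · subst hvw
      exact commute_mk'_colGen_same G 3 v i j
    · exact commute_mk'_colGen_of_adj G (hG v w hvw) i j

end
end

section
/- For every finite simple graph G, 1 ∉ I(G,4); that is, the algebra A(G,K_4) is nontrivial, and hence the algebraic chromatic number satisfies χ_alg(G) ≤ 4. -/
noncomputable section

/-- Words in letters `p v` and `q v b`; they index a basis of a module over `A(K_n, K_4)`. -/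
inductive ColWord (V : Type*)
  | nil : ColWord V
  | p (v : V) (m : ColWord V) : ColWord V
  | q (v : V) (b : Bool) (m : ColWord V) : ColWord V

/-- The complex vector space with basis `ColWord V`. -/
def ColModule (V : Type*) := ColWord V →₀ ℂ

instance (V : Type*) : AddCommGroup (ColModule V) :=
  inferInstanceAs (AddCommGroup (ColWord V →₀ ℂ))

instance (V : Type*) : Module ℂ (ColModule V) :=
  inferInstanceAs (Module ℂ (ColWord V →₀ ℂ))

namespace ColWord

/-- The basis vector indexed by a word. -/
def vec {V : Type*} (m : ColWord V) : ColModule V := Finsupp.single m (1 : ℂ)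

/-- The endomorphism with prescribed values on the basis. -/
def extend {V : Type*} (f : ColWord V → ColModule V) : Module.End ℂ (ColModule V) :=
  Finsupp.linearCombination ℂ f

theorem extend_vec {V : Type*} (f : ColWord V → ColModule V) (m : ColWord V) :
    extend f (vec m) = f m :=
  (Finsupp.linearCombination_single ℂ (1 : ℂ) m).trans (one_smul ℂ (f m))

theorem vec_ne_zero {V : Type*} (m : ColWord V) : vec m ≠ 0 :=
  Finsupp.single_ne_zero.2 one_ne_zero

open scoped Classical in
/-- The action of the idempotent `q v b` on a basis word. -/
def qFun {V : Type*} (v : V) (b : Bool) : ColWord V → ColModule V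
  | nil => vec (q v b nil)
  | p w m => if v = w then 0 else vec (q v b (p w m))
  | q w c m =>
    if v = w then (if b = c then vec (q w c m) else 0)
    else if b = c then 0 else vec (q v b (q w c m))

/-- The linear extension of `qFun`. -/
def qOp {V : Type*} (v : V) (b : Bool) : Module.End ℂ (ColModule V) :=
  extend (qFun v b)

/-- The sum of the two idempotents `q v false` and `q v true`. -/
def fOp {V : Type*} (v : V) : Module.End ℂ (ColModule V) := qOp v false + qOp v true

/-- Words which do not begin with a letter `q v b`. -/
def IsOpen {V : Type*} : ColWord V → Prop
  | q _ _ _ => False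
  | _ => True

open scoped Classical in
/-- The action of the idempotent `p v` on a basis word. -/
def pFun {V : Type*} : ColWord V → V → ColModule V
  | nil, v => vec (p v nil)
  | p w m, v => if v = w then vec (p w m) else 0
  | q w c m, v =>
    if v = w then 0
    else if c = true ∧ m.IsOpen then vec (p v (q w true m))
    else pFun m v - (1 - fOp v) (vec m - pFun m w - fOp w (vec m))
      - if m.IsOpen then vec (p v (q w true m)) else 0

/-- The linear extension of `pFun`. -/
def pOp {V : Type*} (v : V) : Module.End ℂ (ColModule V) :=
  extend fun m => pFun m v

section

variable {V : Type*}

theorem qOp_vec (v : V) (b : Bool) (m : ColWord V) :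
    qOp v b (vec m) = qFun v b m :=
  extend_vec _ _

theorem pOp_vec (v : V) (m : ColWord V) : pOp v (vec m) = pFun m v :=
  extend_vec _ _

theorem end_ext {f g : Module.End ℂ (ColModule V)}
    (h : ∀ m, f (vec m) = g (vec m)) : f = g :=
  Finsupp.lhom_ext' fun m => LinearMap.ext_ring (h m)

theorem qOp_mul_self (v : V) (b : Bool) : qOp v b * qOp v b = qOp v b := by
  refine end_ext fun m => ?_
  rw [Module.End.mul_apply, qOp_vec]
  cases m <;> simp only [qFun] <;> (try split_ifs) <;> simp_all [qOp_vec, qFun]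

theorem qOp_mul_of_ne (v : V) {b c : Bool} (h : b ≠ c) : qOp v b * qOp v c = 0 := by
  refine end_ext fun m => ?_
  rw [Module.End.mul_apply, qOp_vec]
  cases m <;> simp only [qFun] <;> (try split_ifs) <;> simp_all [qOp_vec, qFun]

theorem qOp_mul_qOp {v w : V} (h : v ≠ w) (b : Bool) : qOp v b * qOp w b = 0 := by
  refine end_ext fun m => ?_
  rw [Module.End.mul_apply, qOp_vec]
  cases m <;> simp only [qFun] <;> (try split_ifs) <;> simp_all [qOp_vec, qFun]

theorem qOp_mul_fOp (v : V) (b : Bool) : qOp v b * fOp v = qOp v b := by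
  cases b <;> simp [fOp, mul_add, qOp_mul_self, qOp_mul_of_ne]

theorem fOp_mul_self (v : V) : fOp v * fOp v = fOp v := by
  nth_rw 1 [fOp]
  rw [add_mul, qOp_mul_fOp, qOp_mul_fOp, fOp]

theorem pOp_mul_qOp (v : V) (b : Bool) : pOp v * qOp v b = 0 := by
  refine end_ext fun m => ?_
  rw [Module.End.mul_apply, qOp_vec]
  cases m <;> simp only [qFun] <;> (try split_ifs) <;> simp_all [pOp_vec, pFun]

theorem pOp_mul_fOp_self (v : V) : pOp v * fOp v = 0 := by
  rw [fOp, mul_add, pOp_mul_qOp, pOp_mul_qOp, add_zero]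

theorem qOp_mul_pOp (v : V) (b : Bool) : qOp v b * pOp v = 0 := by
  refine end_ext fun m => ?_
  rw [Module.End.mul_apply, pOp_vec, LinearMap.zero_apply]
  induction m with
  | nil => simp [pFun, qOp_vec, qFun]
  | p w m ih =>
    simp only [pFun]
    split_ifs with h
    · simp [qOp_vec, qFun, h]
    · simp
  | q w c m ih =>
    have key (z) : qOp v b ((1 - fOp v) z) = 0 := by
      rw [← Module.End.mul_apply, mul_sub, qOp_mul_fOp, mul_one, sub_self, LinearMap.zero_apply]
    simp only [pFun]
    split_ifs <;> (try simp only [map_sub, ih, key, map_zero]) <;> simp [qOp_vec, qFun]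

theorem fOp_mul_pOp (v : V) : fOp v * pOp v = 0 := by
  rw [fOp, add_mul, qOp_mul_pOp, qOp_mul_pOp, add_zero]

open scoped Classical in
theorem pOp_mul_fOp {v w : V} (h : v ≠ w) :
    pOp v * fOp w = pOp v - (1 - fOp v) * (1 - pOp w - fOp w) := by
  refine end_ext fun m => ?_
  simp only [Module.End.mul_apply, LinearMap.sub_apply, Module.End.one_apply]
  have hf : fOp w (vec m) = qFun w false m + qFun w true m := by
    simp [fOp, qOp_vec]
  rw [pOp_vec, pOp_vec]
  have hq (c) (m' : ColWord V) : pOp v (vec (q w c m')) = pFun (q w c m') v :=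
    pOp_vec _ _
  have hdef (c) : pFun (q w c m) v = if c = true ∧ m.IsOpen then
      vec (p v (q w true m))
      else pFun m v - (1 - fOp v) (vec m - pFun m w - fOp w (vec m))
      - if m.IsOpen then vec (p v (q w true m)) else 0 := by
    simp [pFun, h]
  cases m with
  | nil =>
    rw [hf]
    simp only [qFun, map_add, hq, hdef, IsOpen]
    rw [hf]
    simp [qFun]
  | p u m =>
    by_cases hu : w = u
    · subst hu
      simp [hf, qFun, pFun, h]
    · rw [hf]
      simp only [qFun, map_add, hq, hdef, IsOpen, hu, if_false]
      rw [hf]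
      simp [qFun, hu]
  | q u c m =>
    by_cases hu : w = u
    · subst hu
      cases c <;> simp [hf, qFun, pFun, pOp_vec, h]
    · cases c
      all_goals
        rw [hf]
        simp only [qFun, hu, if_false, reduceCtorEq, if_true, zero_add, add_zero, hq, hdef,
          IsOpen, and_false]
        rw [hf]
        simp [qFun, hu]

open scoped Classical in
theorem pOp_mul_pOp (v w : V) : pOp v * pOp w = if v = w then pOp v else 0 := by
  refine end_ext fun m => ?_
  rw [Module.End.mul_apply, pOp_vec]
  induction m generalizing v w with
  | nil => split_ifs <;> simp_all [pFun, pOp_vec]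
  | p u m ih => by_cases h : w = u <;> by_cases h' : v = w <;> simp_all [pFun, pOp_vec]
  | q u c m ih =>
    by_cases hwu : w = u
    · split_ifs <;> simp_all [pFun, pOp_vec]
    obtain ⟨z, hz⟩ : ∃ z, z = vec m - pFun m u - fOp u (vec m) :=
      ⟨_, rfl⟩
    have hpz : pOp w z = (1 - fOp w) z := by
      have h1 := LinearMap.congr_fun (pOp_mul_fOp hwu) (vec m)
      simp only [Module.End.mul_apply, LinearMap.sub_apply, Module.End.one_apply] at h1
      have h2 := ih w u
      simp only [hwu, if_false, LinearMap.zero_apply] at h2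
      rw [hz, map_sub, map_sub, h2, h1, pOp_vec u]
      simp
    have hfz : pOp v ((1 - fOp w) z) = if v = w then (1 - fOp w) z else 0 := by
      split_ifs with hvw
      · subst hvw
        rw [← Module.End.mul_apply, mul_sub, pOp_mul_fOp_self, mul_one, sub_zero, hpz]
      · rw [← Module.End.mul_apply, mul_sub, pOp_mul_fOp hvw, mul_one, sub_sub_cancel,
          Module.End.mul_apply]
        simp only [LinearMap.sub_apply, Module.End.one_apply] at hpz ⊢
        simp [hpz]
    have ih' := ih v w
    simp only [pFun, hwu, if_false, ← hz]
    by_cases hvw : v = w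
    · subst hvw
      simp only [if_true] at ih' hfz ⊢
      rw [pOp_vec] at ih' ⊢
      simp only [pFun, hwu, if_false, ← hz]
      split_ifs <;> (try simp only [map_sub, hfz, ih', map_zero]) <;> simp [pOp_vec, pFun]
    · simp only [hvw, if_false, LinearMap.zero_apply] at ih' hfz ⊢
      split_ifs <;> (try simp only [map_sub, hfz, ih', map_zero]) <;> simp [pOp_vec, pFun, hvw]

/-- The four idempotents attached to a vertex. -/
def colOp (v : V) : Fin 4 → Module.End ℂ (ColModule V) :=
  ![1 - pOp v - fOp v, pOp v, qOp v false, qOp v true]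

theorem fOp_mul_qOp (v : V) (b : Bool) : fOp v * qOp v b = qOp v b := by
  cases b <;> simp [fOp, add_mul, qOp_mul_self, qOp_mul_of_ne]

theorem pOp_mul_self (v : V) : pOp v * pOp v = pOp v := by
  simp [pOp_mul_pOp]

theorem sum_colOp (v : V) : ∑ i, colOp v i = 1 := by
  simp [Fin.sum_univ_four, colOp, fOp]
  abel

theorem colOp_mul_self (v : V) (i : Fin 4) : colOp v i * colOp v i = colOp v i := by
  fin_cases i <;> simp [colOp, mul_sub, sub_mul, qOp_mul_self, pOp_mul_self, fOp_mul_self,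
    pOp_mul_fOp_self, fOp_mul_pOp]

theorem colOp_mul_of_ne (v : V) {i j : Fin 4} (h : i ≠ j) : colOp v i * colOp v j = 0 := by
  fin_cases i <;> fin_cases j <;> first
    | exact absurd rfl h
    | simp [colOp, mul_sub, sub_mul, qOp_mul_of_ne, pOp_mul_self, pOp_mul_qOp, qOp_mul_pOp,
        pOp_mul_fOp_self, fOp_mul_pOp, fOp_mul_qOp, qOp_mul_fOp]

theorem colOp_mul_colOp {v w : V} (h : v ≠ w) (i : Fin 4) : colOp v i * colOp w i = 0 := by
  fin_cases i
  · change (1 - pOp v - fOp v) * (1 - pOp w - fOp w) = 0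
    have h1 : pOp v * (1 - pOp w - fOp w) = (1 - fOp v) * (1 - pOp w - fOp w) := by
      conv_lhs => rw [mul_sub, mul_sub, pOp_mul_fOp h, pOp_mul_pOp, if_neg h]
      simp
    rw [sub_right_comm, sub_mul, h1, sub_self]
  · simp [colOp, pOp_mul_pOp, h]
  · simp [colOp, qOp_mul_qOp h]
  · simp [colOp, qOp_mul_qOp h]

end

end ColWord

/-- The representation of the free algebra on the span of `ColWord V`. -/
def colRep (V : Type*) : FreeAlgebra ℂ (V × Fin 4) →ₐ[ℂ] Module.End ℂ (ColModule V) :=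
  FreeAlgebra.lift ℂ fun x => ColWord.colOp x.1 x.2

theorem colRep_colGen {V : Type*} (v : V) (i : Fin 4) :
    colRep V (colGen 4 v i) = ColWord.colOp v i := by
  simp [colRep, colGen]

theorem colIdeal_four_le_ker {V : Type*} (G : SimpleGraph V) :
    colIdeal G 4 ≤ TwoSidedIdeal.ker (colRep V) := by
  refine TwoSidedIdeal.span_le.2 fun a ha => ?_
  rw [SetLike.mem_coe, TwoSidedIdeal.mem_ker]
  obtain ((⟨v, i, j, hij, rfl⟩ | ⟨v, i, rfl⟩) | ⟨v, rfl⟩) | ⟨v, w, i, hvw, rfl⟩ := ha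
  · simp [colRep_colGen, ColWord.colOp_mul_of_ne v hij]
  · simp [colRep_colGen, ColWord.colOp_mul_self]
  · simp only [map_sub, map_one, map_sum, colRep_colGen, ColWord.sum_colOp, sub_self]
  · simp [colRep_colGen, ColWord.colOp_mul_colOp hvw.ne]

/-- For every finite simple graph `G`, `1 ∉ I(G,4)`: the algebra `A(G,K_4)` is
nontrivial, and hence `χ_alg(G) ≤ 4`. -/
theorem one_notMem_colIdeal_four {V : Type*} [Fintype V] (G : SimpleGraph V) :
    ((1 : FreeAlgebra ℂ (V × Fin 4)) ∉ colIdeal G 4) ∧ chiAlg G ≤ 4 := by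
  have h : (1 : FreeAlgebra ℂ (V × Fin 4)) ∉ colIdeal G 4 := fun h1 => by
    have h2 := colIdeal_four_le_ker G h1
    rw [TwoSidedIdeal.mem_ker, map_one] at h2
    have h3 := LinearMap.congr_fun h2 (ColWord.vec ColWord.nil)
    exact ColWord.vec_ne_zero _ h3
  exact ⟨h, Nat.sInf_le h⟩

end
end
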